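/- arXiv:2402.03065 — 3 statements merged into one kernel-verified Lean document; each statement's English description precedes it below -/
import Mathlib

section
/- Let T be a 2-tree on [n−1] with Horn matrix H_T, and let A be the (n−3)×(3n−9) integer matrix whose r-th row (r = 1,…,n−3) has entries 1 in columns 3r−2, 3r−1, 3r and 0 elsewhere. Then A·H_T = 0 and the rank of H_T equals 2n−6; consequently the rows of A span the left kernel of H_T. -/
namespace MinKin

noncomputable section

attribute [local instance] Classical.propDecidable

open scoped BigOperators

/-- First row of the 2×n matrix X, at column `j` (1-based). -/
def colA (n j : ℕ) : ℂ := if j = n then 0 else 1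

/-- Second row of X at column `j` (1-based): `(0,1,x_1,…,x_{n-3},1)`. -/
def colB (n : ℕ) (x : Fin (n - 3) → ℂ) (j : ℕ) : ℂ :=
  if j = 1 then 0
  else if j = 2 then 1
  else if j = n then 1
  else if h : j - 3 < n - 3 then x ⟨j - 3, h⟩ else 0

/-- The Plücker coordinate `p_{ij}(x)`, the 2×2 minor of X on columns i and j. -/
def pc (n : ℕ) (x : Fin (n - 3) → ℂ) (i j : ℕ) : ℂ :=
  colA n i * colB n x j - colA n j * colB n x i

/-- The partial derivative `∂p_{ij}/∂x_m` (with `m : Fin (n-3)` zero-based, so that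
the variable `x m` appears in column `(m:ℕ)+3` of X). -/
def dpc (n : ℕ) (i j : ℕ) (m : Fin (n - 3)) : ℂ :=
  colA n i * (if j = (m : ℕ) + 3 then (1 : ℂ) else 0)
    - colA n j * (if i = (m : ℕ) + 3 then (1 : ℂ) else 0)

/-- The index set `S = {(i,j) : 1 ≤ i < j ≤ n-1, (i,j) ≠ (1,2)}`. -/
def Sfin (n : ℕ) : Finset (ℕ × ℕ) :=
  ((Finset.Icc 1 (n - 1)) ×ˢ (Finset.Icc 1 (n - 1))).filter
    (fun e => e.1 < e.2 ∧ e ≠ (1, 2))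

/-- The domain `U = {x : p_{ij}(x) ≠ 0 for all (i,j) ∈ S}`. -/
def Udom (n : ℕ) : Set (Fin (n - 3) → ℂ) :=
  {x | ∀ e ∈ Sfin n, pc n x e.1 e.2 ≠ 0}

/-- `x` is a critical point of `L_{T₀} = Σ_{e ∈ T₀} s_e · log p_e`. -/
def IsCrit (n : ℕ) (T₀ : Finset (ℕ × ℕ)) (s : ℕ × ℕ → ℂ) (x : Fin (n - 3) → ℂ) : Prop :=
  ∀ m : Fin (n - 3), ∑ e ∈ T₀, s e * dpc n e.1 e.2 m / pc n x e.1 e.2 = 0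

/-- Edge sets built inductively from the parent choices `par`. -/
def edgesUpTo (par : ℕ → ℕ × ℕ) : ℕ → Finset (ℕ × ℕ)
  | 0 => {(1, 2)}
  | k + 1 =>
      if k + 1 < 3 then {(1, 2)}
      else edgesUpTo par k ∪ {((par (k + 1)).1, k + 1), ((par (k + 1)).2, k + 1)}

/-- A 2-tree on `[n-1]`: for each `k = 3,…,n-1` an already-present edge
`par k = (i_k, j_k)` with `i_k < j_k ≤ k-1` is chosen, and the edges
`(i_k, k)` and `(j_k, k)` are added. -/
structure TwoTree (n : ℕ) : Type where
  par : ℕ → ℕ × ℕ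
  lt : ∀ k, 3 ≤ k → k ≤ n - 1 → (par k).1 < (par k).2 ∧ (par k).2 < k
  mem : ∀ k, 3 ≤ k → k ≤ n - 1 → par k ∈ edgesUpTo par (k - 1)

/-- The edge set of a 2-tree. -/
def TwoTree.edges {n : ℕ} (T : TwoTree n) : Finset (ℕ × ℕ) := edgesUpTo T.par (n - 1)

/-- A finite edge set is a 2-tree on `[n-1]`. -/
def IsTwoTree (n : ℕ) (E : Finset (ℕ × ℕ)) : Prop := ∃ T : TwoTree n, T.edges = E

/-- `c` is a child of `e` in the 2-tree `T`. -/
def Child (n : ℕ) (T : TwoTree n) (e c : ℕ × ℕ) : Prop :=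
  ∃ k, 3 ≤ k ∧ k ≤ n - 1 ∧ T.par k = e ∧ (c = (e.1, k) ∨ c = (e.2, k))

/-- The set `dec(e)` of descendants of the edge `e` (including `e` itself). -/
def dec (n : ℕ) (T : TwoTree n) (e : ℕ × ℕ) : Finset (ℕ × ℕ) :=
  T.edges.filter (fun f => Relation.ReflTransGen (Child n T) e f)

/-- The bracket `[s_e] = Σ_{f ∈ dec(e)} s_f`. -/
def brk (n : ℕ) (T : TwoTree n) (s : ℕ × ℕ → ℂ) (e : ℕ × ℕ) : ℂ :=
  ∑ f ∈ dec n T e, s f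

/-- The Mandelstam invariants `s` are generic for `T`. -/
def Generic (n : ℕ) (T : TwoTree n) (s : ℕ × ℕ → ℂ) : Prop :=
  ∀ k, 3 ≤ k → k ≤ n - 1 →
    brk n T s ((T.par k).1, k) ≠ 0 ∧ brk n T s ((T.par k).2, k) ≠ 0 ∧
      brk n T s ((T.par k).1, k) + brk n T s ((T.par k).2, k) ≠ 0

/-- `a_e = |dec(e)|`. -/
def aA (n : ℕ) (T : TwoTree n) (e : ℕ × ℕ) : ℕ := (dec n T e).card

/-- `v_T(e)`: the number of triangles of `T` containing the edge `e`. -/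
def vT (n : ℕ) (T : TwoTree n) (e : ℕ × ℕ) : ℕ :=
  ((Finset.Icc 3 (n - 1)).filter
    (fun k => e = T.par k ∨ e = ((T.par k).1, k) ∨ e = ((T.par k).2, k))).card

/-- The Horn product `P_e(s)`: over all ancestral triangles `{i,j,k}` of `e`, the
factor `[s_c]/([s_{(i,k)}]+[s_{(j,k)}])` where `c` is the child containing `e`
among its descendants. -/
def hornP (n : ℕ) (T : TwoTree n) (s : ℕ × ℕ → ℂ) (e : ℕ × ℕ) : ℂ :=
  ∏ k ∈ Finset.Icc 3 (n - 1),
    (if e ∈ dec n T ((T.par k).1, k) then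
        brk n T s ((T.par k).1, k)
          / (brk n T s ((T.par k).1, k) + brk n T s ((T.par k).2, k))
      else if e ∈ dec n T ((T.par k).2, k) then
        brk n T s ((T.par k).2, k)
          / (brk n T s ((T.par k).1, k) + brk n T s ((T.par k).2, k))
      else 1)

/-- Auxiliary recursion for the signs `ε_e`. -/
def epsAux (par : ℕ → ℕ × ℕ) : ℕ → ℕ × ℕ → ℂ
  | 0, _ => 1
  | k + 1, e =>
      if e = (1, 2) then 1
      else if e = ((par (k + 1)).1, k + 1) then epsAux par k (par (k + 1))
      else if e = ((par (k + 1)).2, k + 1) then -(epsAux par k (par (k + 1)))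
      else epsAux par k e

/-- The sign `ε_e ∈ {1,-1}`: `ε_{(1,2)} = 1`, `ε_{(i,k)} = ε_{(i,j)}`,
`ε_{(j,k)} = -ε_{(i,j)}` for each triangle `{i,j,k}`. -/
def eps (n : ℕ) (T : TwoTree n) (e : ℕ × ℕ) : ℂ := epsAux T.par (n - 1) e

/-- The negated Hessian matrix `𝓗(x) = -Hess(L_{T₀})(x)`. -/
def negHess (n : ℕ) (T₀ : Finset (ℕ × ℕ)) (s : ℕ × ℕ → ℂ) (x : Fin (n - 3) → ℂ) :
    Matrix (Fin (n - 3)) (Fin (n - 3)) ℂ :=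
  Matrix.of fun (l m : Fin (n - 3)) =>
    ∑ e ∈ T₀, s e * dpc n e.1 e.2 l * dpc n e.1 e.2 m / pc n x e.1 e.2 ^ 2

/-- The on-shell diagram of `T`: the triangles of `T` together with `(1,2,n)`. -/
def triples (n : ℕ) (T : TwoTree n) : Finset (ℕ × ℕ × ℕ) :=
  insert (1, 2, n) ((Finset.Icc 3 (n - 1)).image fun k => ((T.par k).1, (T.par k).2, k))

/-- The edge `e` is contained in the triple `t`. -/
def inTriple (e : ℕ × ℕ) (t : ℕ × ℕ × ℕ) : Prop :=
  e = (t.1, t.2.1) ∨ e = (t.1, t.2.2) ∨ e = (t.2.1, t.2.2)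

/-- `ṽ(e)`: the number of triples of the on-shell diagram containing `e`. -/
def vTil (n : ℕ) (T : TwoTree n) (e : ℕ × ℕ) : ℕ :=
  ((triples n T).filter (inTriple e)).card

/-- The edges contained in at least one triple of the on-shell diagram. -/
def diagEdges (n : ℕ) (T : TwoTree n) : Finset (ℕ × ℕ) :=
  (triples n T).biUnion fun t => {(t.1, t.2.1), (t.1, t.2.2), (t.2.1, t.2.2)}

/-- The CHY integrand `I_T(x) = Π_e p_e(x)^{ṽ(e)-2}`. -/
def integrand (n : ℕ) (T : TwoTree n) (x : Fin (n - 3) → ℂ) : ℂ :=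
  ∏ e ∈ diagEdges n T, pc n x e.1 e.2 ^ ((vTil n T e : ℤ) - 2)

/-- The Horn matrix `H_T`: rows come in consecutive triples indexed by the triangles
(in order k = 3,…,n-1), columns indexed by the non-initial edges of `T`
(in order (i_3,3),(j_3,3),(i_4,4),(j_4,4),…). -/
def HornMat (n : ℕ) (T : TwoTree n) : Matrix (Fin (3 * n - 9)) (Fin (2 * n - 6)) ℤ :=
  Matrix.of fun (ρ : Fin (3 * n - 9)) (c : Fin (2 * n - 6)) =>
    let k := (ρ : ℕ) / 3 + 3
    let c1 : ℕ × ℕ := ((T.par k).1, k)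
    let c2 : ℕ × ℕ := ((T.par k).2, k)
    let kc := (c : ℕ) / 2 + 3
    let e : ℕ × ℕ := if (c : ℕ) % 2 = 0 then ((T.par kc).1, kc) else ((T.par kc).2, kc)
    if (ρ : ℕ) % 3 = 0 then (if e ∈ dec n T c1 then 1 else 0)
    else if (ρ : ℕ) % 3 = 1 then (if e ∈ dec n T c2 then 1 else 0)
    else (if e ∈ dec n T c1 ∨ e ∈ dec n T c2 then -1 else 0)

/-- The matrix `A` whose r-th row has 1 in columns 3r-2, 3r-1, 3r (1-based). -/
def Amat (n : ℕ) : Matrix (Fin (n - 3)) (Fin (3 * n - 9)) ℤ :=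
  Matrix.of fun (r : Fin (n - 3)) (c : Fin (3 * n - 9)) =>
    if (c : ℕ) / 3 = (r : ℕ) then 1 else 0

/-- Polynomial version of the first row of X. -/
def colAP (n : ℕ) (j : ℕ) : MvPolynomial (Fin (n - 3)) ℂ := if j = n then 0 else 1

/-- Polynomial version of the second row of X. -/
def colBP (n : ℕ) (j : ℕ) : MvPolynomial (Fin (n - 3)) ℂ :=
  if j = 1 then 0
  else if j = 2 then 1
  else if j = n then 1
  else if h : j - 3 < n - 3 then MvPolynomial.X ⟨j - 3, h⟩ else 0

/-- The Plücker coordinate `p_{ij}` as a polynomial in `ℂ[x_1,…,x_{n-3}]`. -/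
def pcP (n : ℕ) (i j : ℕ) : MvPolynomial (Fin (n - 3)) ℂ :=
  colAP n i * colBP n j - colAP n j * colBP n i

/-- The r-th triple (0-based row index) of the on-shell diagram of `T`. -/
def tripleOf (n : ℕ) (T : TwoTree n) (r : ℕ) : ℕ × ℕ × ℕ :=
  if r + 3 ≤ n - 1 then ((T.par (r + 3)).1, (T.par (r + 3)).2, r + 3) else (1, 2, n)

/-- The matrix `M_T` over `ℂ[x_1,…,x_{n-3}]`, whose row indexed by a triple
`{i,j,k}` (i<j<k) is `p_{jk}·e_i - p_{ik}·e_j + p_{ij}·e_k`. -/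
def Mmat (n : ℕ) (T : TwoTree n) :
    Matrix (Fin (n - 2)) (Fin n) (MvPolynomial (Fin (n - 3)) ℂ) :=
  Matrix.of fun (r : Fin (n - 2)) (c : Fin n) =>
    if (c : ℕ) + 1 = (tripleOf n T r).1 then
      pcP n (tripleOf n T r).2.1 (tripleOf n T r).2.2
    else if (c : ℕ) + 1 = (tripleOf n T r).2.1 then
      -pcP n (tripleOf n T r).1 (tripleOf n T r).2.2
    else if (c : ℕ) + 1 = (tripleOf n T r).2.2 then
      pcP n (tripleOf n T r).1 (tripleOf n T r).2.1
    else 0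

/-- The matrix `M_T` evaluated at a point `x ∈ ℂ^{n-3}`. -/
def MmatC (n : ℕ) (T : TwoTree n) (x : Fin (n - 3) → ℂ) : Matrix (Fin (n - 2)) (Fin n) ℂ :=
  Matrix.of fun (r : Fin (n - 2)) (c : Fin n) =>
    if (c : ℕ) + 1 = (tripleOf n T r).1 then
      pc n x (tripleOf n T r).2.1 (tripleOf n T r).2.2
    else if (c : ℕ) + 1 = (tripleOf n T r).2.1 then
      -pc n x (tripleOf n T r).1 (tripleOf n T r).2.2
    else if (c : ℕ) + 1 = (tripleOf n T r).2.2 then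
      pc n x (tripleOf n T r).1 (tripleOf n T r).2.1
    else 0

/-- The 2×n matrix X evaluated at `x`. -/
def Xmat (n : ℕ) (x : Fin (n - 3) → ℂ) : Matrix (Fin 2) (Fin n) ℂ :=
  Matrix.of fun (r : Fin 2) (c : Fin n) =>
    if r = 0 then colA n ((c : ℕ) + 1) else colB n x ((c : ℕ) + 1)

/-- The monotone embedding `Fin (n-2) → Fin n` skipping the (0-based) positions
`a < b`. -/
def delCols (n a b : ℕ) (d : Fin (n - 2)) : Fin n :=
  ⟨if (d : ℕ) < a then (d : ℕ) else if (d : ℕ) + 1 < b then (d : ℕ) + 1 else (d : ℕ) + 2, by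
    have := d.isLt; split_ifs <;> omega⟩

/-- The maximal minor of `M_T` obtained by deleting columns `i < j` (1-based). -/
def maxMinor (n : ℕ) (T : TwoTree n) (i j : ℕ) : MvPolynomial (Fin (n - 3)) ℂ :=
  Matrix.det (Matrix.of fun (r d : Fin (n - 2)) => Mmat n T r (delCols n (i - 1) (j - 1) d))

/-- `Δ_T = Π_e p_e^{ṽ(e)-1}`. -/
def DeltaT (n : ℕ) (T : TwoTree n) : MvPolynomial (Fin (n - 3)) ℂ :=
  ∏ e ∈ diagEdges n T, pcP n e.1 e.2 ^ (vTil n T e - 1)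

/-- `T₀` has, for generic coefficients, exactly one critical point in `U`. -/
def UniqueCritGeneric (n : ℕ) (T₀ : Finset (ℕ × ℕ)) : Prop :=
  ∃ g : MvPolynomial {e : ℕ × ℕ // e ∈ T₀} ℂ, g ≠ 0 ∧
    ∀ s : ℕ × ℕ → ℂ, MvPolynomial.eval (fun v => s v.1) g ≠ 0 →
      ∃! x : Fin (n - 3) → ℂ, x ∈ Udom n ∧ IsCrit n T₀ s x

/-- `T₀ ⊆ S` exhibits minimal kinematics. -/
def ExhibitsMinKin (n : ℕ) (T₀ : Finset (ℕ × ℕ)) : Prop :=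
  T₀ ⊆ Sfin n ∧ UniqueCritGeneric n T₀ ∧
    ∀ T₁ : Finset (ℕ × ℕ), T₁ ⊆ Sfin n → T₀ ⊆ T₁ → UniqueCritGeneric n T₁ → T₁ = T₀

lemma sum_fin_mul {M : Type*} [AddCommMonoid M] {m k N : ℕ} (h : m * k = N) (f : Fin N → M) :
    ∑ i, f i = ∑ r : Fin m, ∑ s : Fin k, f ((finProdFinEquiv (r, s)).cast h) := by
  subst h
  rw [← finProdFinEquiv.sum_comp, Fintype.sum_prod_type]
  rfl

lemma edgesUpTo_mono (par : ℕ → ℕ × ℕ) {k m : ℕ} (hk : 3 ≤ k) (h : k ≤ m) :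
    edgesUpTo par k ⊆ edgesUpTo par m := by
  induction m, h using Nat.le_induction with
  | base => exact subset_rfl
  | succ m hm ih =>
    refine ih.trans ?_
    rw [edgesUpTo, if_neg (by omega)]
    exact Finset.subset_union_left

namespace TwoTree

variable {n : ℕ} (T : TwoTree n)

lemma children_mem_edges {k : ℕ} (h3 : 3 ≤ k) (hk : k ≤ n - 1) :
    ((T.par k).1, k) ∈ T.edges ∧ ((T.par k).2, k) ∈ T.edges := by
  obtain ⟨l, rfl⟩ : ∃ l, k = l + 1 := ⟨k - 1, by omega⟩
  have hl : ¬ l + 1 < 3 := by omega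
  constructor <;> refine edgesUpTo_mono T.par h3 hk ?_ <;> simp [edgesUpTo, hl]

variable {T}

lemma _root_.MinKin.Child.snd_lt {a b : ℕ × ℕ} (h : Child n T a b) : a.2 < b.2 := by
  obtain ⟨k, h3, hk, rfl, rfl | rfl⟩ := h <;> exact (T.lt k h3 hk).2

lemma child_parent_unique {a b c : ℕ × ℕ} (ha : Child n T a c) (hb : Child n T b c) : a = b := by
  obtain ⟨k, -, -, rfl, hc⟩ := ha
  obtain ⟨l, -, -, rfl, hc'⟩ := hb
  have hk : c.2 = k := by rcases hc with rfl | rfl <;> rfl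
  have hl : c.2 = l := by rcases hc' with rfl | rfl <;> rfl
  rw [← hk, ← hl]

lemma eq_or_snd_lt_of_descendant {a b : ℕ × ℕ} (h : Relation.ReflTransGen (Child n T) a b) :
    a = b ∨ a.2 < b.2 := by
  induction h with
  | refl => exact Or.inl rfl
  | tail _ hbc ih =>
    rcases ih with rfl | ih
    · exact Or.inr hbc.snd_lt
    · exact Or.inr (ih.trans hbc.snd_lt)

/-- Two edges with the same top vertex and a common descendant coincide. -/
lemma eq_of_common_descendant {a b f : ℕ × ℕ} (hab : a.2 = b.2) (ha : f ∈ dec n T a)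
    (hb : f ∈ dec n T b) : a = b := by
  have ha' := Relation.reflTransGen_swap.2 (Finset.mem_filter.1 ha).2
  have hb' := Relation.reflTransGen_swap.2 (Finset.mem_filter.1 hb).2
  have hu : Relator.RightUnique (Function.swap (Child n T)) :=
    fun _ _ _ h h' => child_parent_unique h h'
  rcases Relation.ReflTransGen.total_of_right_unique hu ha' hb' with h | h
  · rcases eq_or_snd_lt_of_descendant (Relation.reflTransGen_swap.1 h) with h | h
    · exact h.symm
    · omega
  · rcases eq_or_snd_lt_of_descendant (Relation.reflTransGen_swap.1 h) with h | h
    · exact h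
    · omega

variable (T)

/-- The edge indexing the `c`-th column of the Horn matrix. -/
def colEdge (c : ℕ) : ℕ × ℕ :=
  if c % 2 = 0 then ((T.par (c / 2 + 3)).1, c / 2 + 3) else ((T.par (c / 2 + 3)).2, c / 2 + 3)

lemma colEdge_snd (c : ℕ) : (T.colEdge c).2 = c / 2 + 3 := by
  unfold colEdge
  split_ifs <;> rfl

lemma colEdge_mem_edges {c : ℕ} (hc : c < 2 * n - 6) : T.colEdge c ∈ T.edges := by
  have h := T.children_mem_edges (k := c / 2 + 3) (by omega) (by omega)
  unfold colEdge
  split_ifs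
  exacts [h.1, h.2]

lemma le_of_colEdge_mem_dec {c d : ℕ} (hc : c < 2 * n - 6)
    (h : T.colEdge d ∈ dec n T (T.colEdge c)) : c ≤ d := by
  rcases eq_or_snd_lt_of_descendant (Finset.mem_filter.1 h).2 with h | h
  · have h2 := congrArg Prod.snd h
    simp only [colEdge_snd, Nat.add_right_cancel_iff] at h2
    have hlt := (T.lt (c / 2 + 3) (by omega) (by omega)).1
    unfold colEdge at h
    rw [← h2] at h
    split_ifs at h <;> simp only [Prod.mk.injEq, and_true] at h <;> omega
  · simp only [colEdge_snd] at h
    omega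

end TwoTree

/-- The row of the Horn matrix whose edge is the `c`-th column edge. -/
def edgeRow (n : ℕ) (c : Fin (2 * n - 6)) : Fin (3 * n - 9) :=
  ⟨3 * (c / 2) + c % 2, by omega⟩

lemma edgeRow_injective (n : ℕ) : Function.Injective (edgeRow n) := by
  intro c d h
  simp only [edgeRow, Fin.mk.injEq] at h
  omega

lemma hornMat_edgeRow (n : ℕ) (T : TwoTree n) (c d : Fin (2 * n - 6)) :
    HornMat n T (edgeRow n c) d = if T.colEdge d ∈ dec n T (T.colEdge c) then 1 else 0 := by
  have h1 : (3 * ((c : ℕ) / 2) + c % 2) / 3 = c / 2 := by omega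
  have h2 : (3 * ((c : ℕ) / 2) + c % 2) % 3 = c % 2 := by omega
  simp only [HornMat, edgeRow, TwoTree.colEdge, Matrix.of_apply, h1, h2]
  rcases Nat.mod_two_eq_zero_or_one c with h | h <;> simp [h]

lemma det_hornMat_edgeRow (n : ℕ) (T : TwoTree n) :
    ((HornMat n T).submatrix (edgeRow n) id).det = 1 := by
  have ht : ((HornMat n T).submatrix (edgeRow n) id).BlockTriangular id := by
    intro c d hdc
    rw [Matrix.submatrix_apply, id, hornMat_edgeRow, if_neg]
    exact fun h => (T.le_of_colEdge_mem_dec c.2 h).not_gt hdc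
  rw [Matrix.det_of_isUpperTriangular ht]
  refine Finset.prod_eq_one fun c _ => ?_
  rw [Matrix.submatrix_apply, id, hornMat_edgeRow, if_pos]
  exact Finset.mem_filter.2 ⟨T.colEdge_mem_edges c.2, Relation.ReflTransGen.refl⟩

lemma amat_mul_hornMat (n : ℕ) (T : TwoTree n) : Amat n * HornMat n T = 0 := by
  ext r c
  rw [Matrix.mul_apply, sum_fin_mul (m := n - 3) (k := 3) (by omega), Finset.sum_eq_single r]
  · have hlt := (T.lt (r + 3) (by omega) (by omega)).1
    have hd : ∀ f, f ∈ dec n T ((T.par (r + 3)).1, (r : ℕ) + 3) →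
        f ∉ dec n T ((T.par (r + 3)).2, (r : ℕ) + 3) := fun f h1 h2 =>
      hlt.ne (congrArg Prod.fst (TwoTree.eq_of_common_descendant (by rfl) h1 h2))
    have h0 : 3 * (r : ℕ) / 3 = r := by omega
    have h1 : (1 + 3 * (r : ℕ)) / 3 = r := by omega
    have h2 : (2 + 3 * (r : ℕ)) / 3 = r := by omega
    simp only [Amat, HornMat, Fin.sum_univ_three, Matrix.of_apply, Fin.val_cast,
      finProdFinEquiv_apply_val, Fin.val_zero, Fin.val_one, Fin.val_two, zero_add, h0, h1, h2,
      Nat.add_mul_mod_self_left, Matrix.zero_apply]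
    generalize (if (c : ℕ) % 2 = 0 then ((T.par (c / 2 + 3)).1, (c : ℕ) / 2 + 3)
      else ((T.par (c / 2 + 3)).2, (c : ℕ) / 2 + 3)) = e
    have := hd e
    by_cases hx : e ∈ dec n T ((T.par (r + 3)).1, (r : ℕ) + 3) <;>
      by_cases hy : e ∈ dec n T ((T.par (r + 3)).2, (r : ℕ) + 3) <;> simp_all
  · intro q _ hq
    refine Finset.sum_eq_zero fun s _ => ?_
    have hq' : (q : ℕ) ≠ r := fun h => hq (Fin.ext h)
    have : ((s : ℕ) + 3 * q) / 3 ≠ r := by omega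
    simp [Amat, this]
  · simp

lemma vecMul_amat_apply (n : ℕ) (w : Fin (n - 3) → ℚ) (c : Fin (3 * n - 9)) :
    Matrix.vecMul w ((Amat n).map ((↑) : ℤ → ℚ)) c = w ⟨c / 3, by omega⟩ := by
  rw [Matrix.vecMul, dotProduct, Finset.sum_eq_single ⟨c / 3, by omega⟩]
  · simp [Amat]
  · intro r _ hr
    have : (c : ℕ) / 3 ≠ r := fun h => hr (Fin.ext h.symm)
    simp [Amat, this]
  · simp

/-- A left kernel vector of the Horn matrix supported on the edge rows vanishes. -/
lemma eq_zero_of_vecMul_hornMat (n : ℕ) (T : TwoTree n) (v : Fin (3 * n - 9) → ℚ)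
    (hv : Matrix.vecMul v ((HornMat n T).map ((↑) : ℤ → ℚ)) = 0)
    (hsupp : ∀ ρ ∉ Set.range (edgeRow n), v ρ = 0) : v = 0 := by
  have hdet : (((HornMat n T).submatrix (edgeRow n) id).map (Int.castRingHom ℚ)).det ≠ 0 := by
    rw [← RingHom.mapMatrix_apply, ← RingHom.map_det, det_hornMat_edgeRow]
    simp
  have hzero : v ∘ edgeRow n = 0 := by
    refine Matrix.eq_zero_of_vecMul_eq_zero hdet (Eq.trans ?_ hv)
    ext c
    exact Fintype.sum_of_injective _ (edgeRow_injective n) _ _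
      (fun ρ hρ => by simp [hsupp ρ hρ]) fun _ => rfl
  ext ρ
  by_cases hρ : ρ ∈ Set.range (edgeRow n)
  · obtain ⟨c, rfl⟩ := hρ
    exact congrFun hzero c
  · exact hsupp ρ hρ

lemma rank_hornMat (n : ℕ) (T : TwoTree n) :
    ((HornMat n T).map ((↑) : ℤ → ℚ)).rank = 2 * n - 6 := by
  refine le_antisymm ((Matrix.rank_le_card_width _).trans_eq (Fintype.card_fin _)) ?_
  have hunit : IsUnit (((HornMat n T).submatrix (edgeRow n) id).map (Int.castRingHom ℚ)) := by
    rw [Matrix.isUnit_iff_isUnit_det, ← RingHom.mapMatrix_apply, ← RingHom.map_det,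
      det_hornMat_edgeRow, map_one]
    exact isUnit_one
  calc 2 * n - 6
      = (((HornMat n T).submatrix (edgeRow n) id).map (Int.castRingHom ℚ)).rank := by
        rw [Matrix.rank_of_isUnit _ hunit, Fintype.card_fin]
    _ = (((HornMat n T).map ((↑) : ℤ → ℚ)).submatrix (edgeRow n) id).rank := by
        rw [← Matrix.submatrix_map, Int.coe_castRingHom]
    _ ≤ _ := Matrix.rank_submatrix_le _ _ _

/-- A·H_T = 0, rank H_T = 2n-6, and the rows of A span the left
kernel of H_T. -/
theorem horn_matrix_left_kernel (n : ℕ) (hn : 4 ≤ n) (T : TwoTree n) :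
    Amat n * HornMat n T = 0 ∧
      ((HornMat n T).map ((↑) : ℤ → ℚ)).rank = 2 * n - 6 ∧
      ∀ v : Fin (3 * n - 9) → ℚ,
        Matrix.vecMul v ((HornMat n T).map ((↑) : ℤ → ℚ)) = 0 ↔
          ∃ w : Fin (n - 3) → ℚ, v = Matrix.vecMul w ((Amat n).map ((↑) : ℤ → ℚ)) := by
  have hA : (Amat n).map ((↑) : ℤ → ℚ) * (HornMat n T).map ((↑) : ℤ → ℚ) = 0 := by
    change (Amat n).map (Int.castRingHom ℚ) * (HornMat n T).map (Int.castRingHom ℚ) = 0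
    rw [← Matrix.map_mul, amat_mul_hornMat, Matrix.map_zero _ (map_zero _)]
  refine ⟨amat_mul_hornMat n T, rank_hornMat n T, fun v => ⟨fun hv => ?_, ?_⟩⟩
  · refine ⟨fun r => v ⟨3 * r + 2, by omega⟩, ?_⟩
    refine sub_eq_zero.1 (eq_zero_of_vecMul_hornMat n T _ ?_ fun ρ hρ => ?_)
    · rw [Matrix.sub_vecMul, hv, Matrix.vecMul_vecMul, hA, Matrix.vecMul_zero, sub_zero]
    · have h2 : (ρ : ℕ) % 3 = 2 := by
        by_contra h
        refine hρ ⟨⟨2 * (ρ / 3) + ρ % 3, by omega⟩, Fin.ext ?_⟩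
        simp only [edgeRow]
        omega
      rw [Pi.sub_apply, vecMul_amat_apply, sub_eq_zero]
      congr 1
      ext
      simp only
      omega
  · rintro ⟨w, rfl⟩
    rw [Matrix.vecMul_vecMul, hA, Matrix.vecMul_zero]

end
end MinKin
end

section
/- Let T be a 2-tree on [n−1] and suppose the Mandelstam invariants s are generic for T. Then for every triangle {i,j,k} of T with i < j < k one has P_{{i,k}}(s) + P_{{j,k}}(s) = P_{{i,j}}(s); consequently ε_{{i,k}}·P_{{i,k}}(s) − ε_{{j,k}}·P_{{j,k}}(s) = ε_{{i,j}}·P_{{i,j}}(s), i.e. the Horn point p̂ with coordinates p̂_e = ε_e·P_e(s) satisfies all the trinomial equations p̂_{{i,k}} − p̂_{{j,k}} = p̂_{{i,j}} that cut out the very affine variety X_T. -/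
namespace MinKin

noncomputable section

attribute [local instance] Classical.propDecidable

open scoped BigOperators

theorem edgesUpTo_mono_s6 (par : ℕ → ℕ × ℕ) : Monotone (edgesUpTo par) := by
  refine monotone_nat_of_le_succ fun k => ?_
  by_cases h : k + 1 < 3
  · obtain rfl | rfl : k = 0 ∨ k = 1 := by omega
    all_goals simp [edgesUpTo]
  · rw [edgesUpTo.eq_2, if_neg h]
    exact Finset.subset_union_left

theorem par_mem_edges {n : ℕ} (T : TwoTree n) {k : ℕ} (h3 : 3 ≤ k) (hk : k ≤ n - 1) :
    T.par k ∈ T.edges :=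
  edgesUpTo_mono_s6 T.par (by omega : k - 1 ≤ n - 1) (T.mem k h3 hk)

theorem child_mem_edges {n : ℕ} (T : TwoTree n) {k : ℕ} (h3 : 3 ≤ k) (hk : k ≤ n - 1)
    {a : ℕ} (ha : a = (T.par k).1 ∨ a = (T.par k).2) : (a, k) ∈ T.edges := by
  refine edgesUpTo_mono_s6 T.par hk ?_
  obtain ⟨m, rfl⟩ : ∃ m, k = m + 1 := ⟨k - 1, by omega⟩
  rw [edgesUpTo.eq_2, if_neg (by omega)]
  rcases ha with rfl | rfl <;> simp

/-- The larger vertex of an edge does not decrease along descent. -/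
theorem snd_le_of_descendant {n : ℕ} (T : TwoTree n) {e f : ℕ × ℕ}
    (h : Relation.ReflTransGen (Child n T) e f) : e.2 ≤ f.2 := by
  induction h with
  | refl => exact le_rfl
  | tail _ hc ih =>
    obtain ⟨l, h3, hl, rfl, rfl | rfl⟩ := hc
    all_goals exact ih.trans (T.lt l h3 hl).2.le

/-- Every proper ancestor of a child edge `(a, k)` is an ancestor of its parent. -/
theorem child_mem_dec_iff {n : ℕ} (T : TwoTree n) {k : ℕ} (h3 : 3 ≤ k) (hk : k ≤ n - 1)
    {a : ℕ} (ha : a = (T.par k).1 ∨ a = (T.par k).2) (e : ℕ × ℕ) :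
    (a, k) ∈ dec n T e ↔ e = (a, k) ∨ T.par k ∈ dec n T e := by
  simp only [dec, Finset.mem_filter, child_mem_edges T h3 hk ha, par_mem_edges T h3 hk,
    true_and]
  constructor
  · intro h
    rcases Relation.ReflTransGen.cases_tail h with h | ⟨p, hp, l, -, -, rfl, h | h⟩
    · exact Or.inl h.symm
    all_goals
      obtain rfl : k = l := congrArg Prod.snd h
      exact Or.inr hp
  · rintro (rfl | h)
    · exact .refl
    · exact h.tail ⟨k, h3, hk, rfl, by simpa [Prod.ext_iff] using ha⟩

theorem par_notMem_dec_child {n : ℕ} (T : TwoTree n) {k : ℕ} (h3 : 3 ≤ k) (hk : k ≤ n - 1)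
    (a : ℕ) : T.par k ∉ dec n T (a, k) := fun h =>
  (T.lt k h3 hk).2.not_ge (snd_le_of_descendant T (Finset.mem_filter.1 h).2)

/-- Passing from an edge to one of its children multiplies the Horn product by one factor. -/
theorem hornP_child {n : ℕ} (T : TwoTree n) (s : ℕ × ℕ → ℂ) {k : ℕ} (h3 : 3 ≤ k)
    (hk : k ≤ n - 1) {a : ℕ} (ha : a = (T.par k).1 ∨ a = (T.par k).2) :
    hornP n T s (a, k) = brk n T s (a, k)
      / (brk n T s ((T.par k).1, k) + brk n T s ((T.par k).2, k)) * hornP n T s (T.par k) := by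
  have hmem : k ∈ Finset.Icc 3 (n - 1) := Finset.mem_Icc.2 ⟨h3, hk⟩
  have hlt := (T.lt k h3 hk).1
  unfold hornP
  rw [← Finset.mul_prod_erase _ _ hmem, ← Finset.mul_prod_erase _ _ hmem,
    if_neg (par_notMem_dec_child T h3 hk _), if_neg (par_notMem_dec_child T h3 hk _), one_mul]
  congr 1
  · simp only [child_mem_dec_iff T h3 hk ha, par_notMem_dec_child T h3 hk, or_false,
      Prod.mk.injEq, and_true]
    rcases ha with rfl | rfl
    · rw [if_pos rfl]
    · rw [if_neg hlt.ne, if_pos rfl]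
  · refine Finset.prod_congr rfl fun l hl => ?_
    have hne : l ≠ k := Finset.ne_of_mem_erase hl
    simp only [child_mem_dec_iff T h3 hk ha, Prod.mk.injEq, hne, and_false, false_or]

/-- The sign recursion is stationary above the larger vertex of the edge. -/
theorem epsAux_eq_of_le (par : ℕ → ℕ × ℕ) {e : ℕ × ℕ} {m N : ℕ} (he : e.2 ≤ m)
    (hmN : m ≤ N) : epsAux par N e = epsAux par m e := by
  induction N, hmN using Nat.le_induction with
  | base => rfl
  | succ N hN ih =>
    have hne : ∀ a, e ≠ (a, N + 1) := fun a h => by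
      have := congrArg Prod.snd h
      simp only at this
      omega
    rw [epsAux.eq_2, if_neg (hne _), if_neg (hne _), ih]
    split_ifs with h
    · subst h
      cases m <;> simp [epsAux]
    · rfl

theorem eps_children {n : ℕ} (T : TwoTree n) {k : ℕ} (h3 : 3 ≤ k) (hk : k ≤ n - 1) :
    eps n T ((T.par k).1, k) = eps n T (T.par k) ∧
      eps n T ((T.par k).2, k) = -eps n T (T.par k) := by
  obtain ⟨hlt, hltk⟩ := T.lt k h3 hk
  obtain ⟨m, rfl⟩ : ∃ m, k = m + 1 := ⟨k - 1, by omega⟩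
  have hm : m + 1 ≠ 2 := by omega
  unfold eps
  rw [epsAux_eq_of_le T.par (e := ((T.par (m + 1)).1, m + 1)) le_rfl hk,
    epsAux_eq_of_le T.par (e := ((T.par (m + 1)).2, m + 1)) le_rfl hk,
    epsAux_eq_of_le T.par (Nat.le_of_lt_succ hltk) (by omega : m ≤ n - 1)]
  constructor
  · rw [epsAux.eq_2, if_neg (by simp [hm]), if_pos rfl]
  · rw [epsAux.eq_2, if_neg (by simp [hm]), if_neg (by simp [hlt.ne']), if_pos rfl]

/-- for every triangle {i,j,k} of T one has
P_{ik} + P_{jk} = P_{ij}, hence ε_{ik}P_{ik} - ε_{jk}P_{jk} = ε_{ij}P_{ij}. -/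
theorem horn_point_trinomials (n : ℕ) (hn : 4 ≤ n) (T : TwoTree n)
    (s : ℕ × ℕ → ℂ) (hs : Generic n T s) :
    ∀ k, 3 ≤ k → k ≤ n - 1 →
      hornP n T s ((T.par k).1, k) + hornP n T s ((T.par k).2, k)
          = hornP n T s (T.par k) ∧
        eps n T ((T.par k).1, k) * hornP n T s ((T.par k).1, k)
            - eps n T ((T.par k).2, k) * hornP n T s ((T.par k).2, k)
          = eps n T (T.par k) * hornP n T s (T.par k) := by
  intro k h3 hk
  obtain ⟨-, -, h⟩ := hs k h3 hk
  obtain ⟨h1, h2⟩ := eps_children T h3 hk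
  have key : hornP n T s ((T.par k).1, k) + hornP n T s ((T.par k).2, k)
      = hornP n T s (T.par k) := by
    rw [hornP_child T s h3 hk (.inl rfl), hornP_child T s h3 hk (.inr rfl), ← add_mul,
      ← add_div, div_self h, one_mul]
  refine ⟨key, ?_⟩
  rw [h1, h2, ← key]
  ring

end
end MinKin
end

section
/- Let T be a 2-tree on [n−1], suppose the Mandelstam invariants s are generic for T, and let x̂ ∈ U be a critical point of the scattering potential L_T. Then the determinant of the negated Hessian 𝓗(x̂) = −Hess(L_T)(x̂) equals the product, over all triangles {i,j,k} of T with i < j < k, of ([s_{{i,k}}] + [s_{{j,k}}])^{b_k} / ([s_{{i,k}}]^{a_{{i,k}}} · [s_{{j,k}}]^{a_{{j,k}}}); equivalently, det Hess(L_T)(x̂) = (−1)^{n−3} times this product. -/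
namespace MinKin

noncomputable section

attribute [local instance] Classical.propDecidable

open scoped BigOperators

namespace TwoTree

variable {n : ℕ} (T : TwoTree n)

/-- The child `{i_k, k}` created with the vertex `k`. -/
abbrev left (k : ℕ) : ℕ × ℕ := ((T.par k).1, k)

/-- The child `{j_k, k}` created with the vertex `k`. -/
abbrev right (k : ℕ) : ℕ × ℕ := ((T.par k).2, k)

theorem _root_.MinKin.mem_edgesUpTo (par : ℕ → ℕ × ℕ) (m : ℕ) (e : ℕ × ℕ) :
    e ∈ edgesUpTo par m ↔ e = (1, 2) ∨ ∃ k, 3 ≤ k ∧ k ≤ m ∧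
      (e = ((par k).1, k) ∨ e = ((par k).2, k)) := by
  induction m with
  | zero =>
    simp only [edgesUpTo, Finset.mem_singleton]
    refine ⟨Or.inl, ?_⟩
    rintro (h | ⟨k, h3, h0, -⟩)
    · exact h
    · omega
  | succ m ih =>
    rw [edgesUpTo]
    split_ifs with hm
    · simp only [Finset.mem_singleton]
      refine ⟨Or.inl, ?_⟩
      rintro (h | ⟨k, h3, h0, -⟩)
      · exact h
      · omega
    · simp only [Finset.mem_union, ih, Finset.mem_insert, Finset.mem_singleton]
      constructor
      · rintro ((h | ⟨k, h3, hk, h⟩) | h)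
        · exact Or.inl h
        · exact Or.inr ⟨k, h3, by omega, h⟩
        · exact Or.inr ⟨m + 1, by omega, le_rfl, h⟩
      · rintro (h | ⟨k, h3, hk, h⟩)
        · exact Or.inl (Or.inl h)
        · rcases Nat.le_succ_iff.1 hk with hk | rfl
          · exact Or.inl (Or.inr ⟨k, h3, hk, h⟩)
          · exact Or.inr h

theorem mem_edges (e : ℕ × ℕ) :
    e ∈ T.edges ↔ e = (1, 2) ∨ ∃ k, 3 ≤ k ∧ k ≤ n - 1 ∧ (e = T.left k ∨ e = T.right k) :=
  mem_edgesUpTo T.par (n - 1) e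

theorem par_mem_edges {k : ℕ} (h3 : 3 ≤ k) (hk : k ≤ n - 1) : T.par k ∈ T.edges := by
  rcases (mem_edgesUpTo _ _ _).1 (T.mem k h3 hk) with h | ⟨l, h3', hl, h⟩
  · exact (T.mem_edges _).2 (Or.inl h)
  · exact (T.mem_edges _).2 (Or.inr ⟨l, h3', by omega, h⟩)

theorem left_mem_edges {k : ℕ} (h3 : 3 ≤ k) (hk : k ≤ n - 1) : T.left k ∈ T.edges :=
  (T.mem_edges _).2 (Or.inr ⟨k, h3, hk, Or.inl rfl⟩)

theorem right_mem_edges {k : ℕ} (h3 : 3 ≤ k) (hk : k ≤ n - 1) : T.right k ∈ T.edges :=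
  (T.mem_edges _).2 (Or.inr ⟨k, h3, hk, Or.inr rfl⟩)

theorem bounds_of_mem_edges (hn : 4 ≤ n) {e : ℕ × ℕ} (he : e ∈ T.edges) :
    1 ≤ e.1 ∧ e.1 < e.2 ∧ e.2 ≤ n - 1 := by
  induction h : e.2 using Nat.strong_induction_on generalizing e with
  | _ m ih =>
    rcases (T.mem_edges e).1 he with rfl | ⟨k, h3, hk, h'⟩
    · simp only at h ⊢; omega
    · have hlt := T.lt k h3 hk
      have hkm : k = m := by rcases h' with rfl | rfl <;> exact h
      have := ih (T.par k).2 (by omega) (T.par_mem_edges h3 hk) rfl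
      rcases h' with rfl | rfl <;> simp only <;> omega

theorem mem_Sfin_of_mem_edges (hn : 4 ≤ n) {e : ℕ × ℕ} (he : e ∈ T.edges) (h : e ≠ (1, 2)) :
    e ∈ Sfin n := by
  have := T.bounds_of_mem_edges hn he
  simp only [Sfin, Finset.mem_filter, Finset.mem_product, Finset.mem_Icc]
  refine ⟨⟨⟨?_, ?_⟩, ?_, ?_⟩, ?_, h⟩ <;> omega

@[to_additive]
theorem prod_edges_erase {M : Type*} [CommMonoid M] (f : ℕ × ℕ → M) :
    ∏ e ∈ T.edges.erase (1, 2), f e =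
      ∏ k ∈ Finset.Icc 3 (n - 1), f (T.left k) * f (T.right k) := by
  have hE : T.edges.erase (1, 2) =
      (Finset.Icc 3 (n - 1)).biUnion fun k => {T.left k, T.right k} := by
    ext e
    simp only [Finset.mem_erase, mem_edges, Finset.mem_biUnion, Finset.mem_Icc,
      Finset.mem_insert, Finset.mem_singleton]
    constructor
    · rintro ⟨h, h' | ⟨k, h3, hk, h'⟩⟩
      · exact absurd h' h
      · exact ⟨k, ⟨h3, hk⟩, h'⟩
    · rintro ⟨k, ⟨h3, hk⟩, h'⟩
      refine ⟨?_, Or.inr ⟨k, h3, hk, h'⟩⟩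
      rintro rfl
      simp only [Prod.mk.injEq] at h'
      omega
  rw [hE, Finset.prod_biUnion]
  · refine Finset.prod_congr rfl fun k hk => Finset.prod_pair ?_
    have := (T.lt k (Finset.mem_Icc.1 hk).1 (Finset.mem_Icc.1 hk).2).1
    simp only [ne_eq, Prod.mk.injEq, and_true]
    omega
  · intro k _ l _ hkl
    simp only [Function.onFun]
    rw [Finset.disjoint_left]
    intro e he he'
    simp only [Finset.mem_insert, Finset.mem_singleton] at he he'
    apply hkl
    have h1 : e.2 = k := by rcases he with rfl | rfl <;> rfl
    have h2 : e.2 = l := by rcases he' with rfl | rfl <;> rfl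
    rw [← h1, h2]

/-- Regrouping a product over triangles by the parent edge. -/
@[to_additive]
theorem prod_edges_prod_fiber {M : Type*} [CommMonoid M] (F : ℕ → ℕ × ℕ → M)
    (h12 : ∀ k, F k (1, 2) = 1) :
    ∏ e ∈ T.edges.erase (1, 2), ∏ k ∈ Finset.Icc 3 (n - 1) with T.par k = e, F k e =
      ∏ k ∈ Finset.Icc 3 (n - 1), F k (T.par k) := by
  simp only [Finset.prod_filter]
  rw [Finset.prod_comm]
  refine Finset.prod_congr rfl fun k hk => ?_
  rw [Finset.prod_ite_eq]
  split_ifs with h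
  · rfl
  · have : T.par k = (1, 2) := by
      by_contra h'
      exact h (Finset.mem_erase.2
        ⟨h', T.par_mem_edges (Finset.mem_Icc.1 hk).1 (Finset.mem_Icc.1 hk).2⟩)
    rw [this, h12]

variable {T}

theorem child_left {k : ℕ} (h3 : 3 ≤ k) (hk : k ≤ n - 1) : Child n T (T.par k) (T.left k) :=
  ⟨k, h3, hk, rfl, Or.inl rfl⟩

theorem child_right {k : ℕ} (h3 : 3 ≤ k) (hk : k ≤ n - 1) : Child n T (T.par k) (T.right k) :=
  ⟨k, h3, hk, rfl, Or.inr rfl⟩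

theorem _root_.MinKin.Child.par_eq {e c : ℕ × ℕ} (h : Child n T e c) : T.par c.2 = e := by
  obtain ⟨k, -, -, h, rfl | rfl⟩ := h <;> exact h

theorem _root_.MinKin.Child.snd_lt_s9 {e c : ℕ × ℕ} (h : Child n T e c) : e.2 < c.2 := by
  obtain ⟨k, h3, hk, rfl, rfl | rfl⟩ := h <;> exact (T.lt k h3 hk).2

theorem snd_le_of_reflTransGen {e f : ℕ × ℕ}
    (h : Relation.ReflTransGen (Child n T) e f) : e.2 ≤ f.2 := by
  induction h with
  | refl => rfl
  | tail _ h ih => exact ih.trans h.snd_lt_s9.le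

theorem notMem_dec_of_child {e c : ℕ × ℕ} (h : Child n T e c) : e ∉ dec n T c := by
  intro h'
  exact absurd (snd_le_of_reflTransGen (Finset.mem_filter.1 h').2) (not_le.2 h.snd_lt_s9)

theorem reflTransGen_sibling_eq {e c d : ℕ × ℕ} (hc : Child n T e c) (hd : Child n T e d)
    (h : Relation.ReflTransGen (Child n T) c d) : c = d := by
  rcases h.cases_tail with h | ⟨f, hf, hfd⟩
  · exact h.symm
  · have : f = e := hfd.par_eq.symm.trans hd.par_eq
    subst this
    exact absurd (snd_le_of_reflTransGen hf) (not_le.2 hc.snd_lt_s9)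

theorem disjoint_dec_of_sibling {e c d : ℕ × ℕ} (hc : Child n T e c) (hd : Child n T e d)
    (hcd : c ≠ d) : Disjoint (dec n T c) (dec n T d) := by
  rw [Finset.disjoint_left]
  intro f hfc hfd
  have h1 := (Finset.mem_filter.1 hfc).2.swap
  have h2 := (Finset.mem_filter.1 hfd).2.swap
  have hu : Relator.RightUnique (Function.swap (Child n T)) :=
    fun _ _ _ h h' => h.par_eq.symm.trans h'.par_eq
  rcases Relation.ReflTransGen.total_of_right_unique hu h1 h2 with h | h
  · exact hcd (reflTransGen_sibling_eq hd hc h.swap).symm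
  · exact hcd (reflTransGen_sibling_eq hc hd h.swap)

variable (T)

theorem dec_eq_insert {e : ℕ × ℕ} (he : e ∈ T.edges) :
    dec n T e = insert e ((Finset.Icc 3 (n - 1)).filter (T.par · = e) |>.biUnion fun k =>
      dec n T (T.left k) ∪ dec n T (T.right k)) := by
  ext f
  simp only [Finset.mem_insert, Finset.mem_biUnion, Finset.mem_filter, Finset.mem_Icc,
    Finset.mem_union, dec]
  constructor
  · rintro ⟨hf, h⟩
    rcases h.cases_head with h | ⟨c, ⟨k, h3, hk, rfl, rfl | rfl⟩, h⟩
    · exact Or.inl h.symm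
    · exact Or.inr ⟨k, ⟨⟨h3, hk⟩, rfl⟩, Or.inl ⟨hf, h⟩⟩
    · exact Or.inr ⟨k, ⟨⟨h3, hk⟩, rfl⟩, Or.inr ⟨hf, h⟩⟩
  · rintro (rfl | ⟨k, ⟨⟨h3, hk⟩, rfl⟩, ⟨hf, h⟩ | ⟨hf, h⟩⟩)
    · exact ⟨he, .refl⟩
    · exact ⟨hf, h.head (child_left h3 hk)⟩
    · exact ⟨hf, h.head (child_right h3 hk)⟩

theorem sum_dec {M : Type*} [AddCommMonoid M] (t : ℕ × ℕ → M) {e : ℕ × ℕ} (he : e ∈ T.edges) :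
    ∑ f ∈ dec n T e, t f = t e + ∑ k ∈ Finset.Icc 3 (n - 1) with T.par k = e,
      (∑ f ∈ dec n T (T.left k), t f + ∑ f ∈ dec n T (T.right k), t f) := by
  have key : ∀ k ∈ (Finset.Icc 3 (n - 1)).filter (T.par · = e),
      Child n T e (T.left k) ∧ Child n T e (T.right k) ∧ T.left k ≠ T.right k := by
    intro k hk
    obtain ⟨hI, rfl⟩ := Finset.mem_filter.1 hk
    obtain ⟨h3, hk⟩ := Finset.mem_Icc.1 hI
    refine ⟨child_left h3 hk, child_right h3 hk, fun h => ?_⟩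
    exact (T.lt k h3 hk).1.ne (congrArg Prod.fst h)
  rw [T.dec_eq_insert he, Finset.sum_insert, Finset.sum_biUnion]
  · congr 1
    refine Finset.sum_congr rfl fun k hk => ?_
    obtain ⟨h1, h2, h⟩ := key k hk
    exact Finset.sum_union (disjoint_dec_of_sibling h1 h2 h)
  · intro k hk l hl hkl
    obtain ⟨h1, h2, -⟩ := key k hk
    obtain ⟨h3, h4, -⟩ := key l hl
    have hne : ∀ a b, ((a, k) : ℕ × ℕ) ≠ (b, l) := fun a b h => hkl (congrArg Prod.snd h)
    simp only [Function.onFun, Finset.disjoint_union_left, Finset.disjoint_union_right]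
    exact ⟨⟨disjoint_dec_of_sibling h1 h3 (hne _ _), disjoint_dec_of_sibling h2 h3 (hne _ _)⟩,
      disjoint_dec_of_sibling h1 h4 (hne _ _), disjoint_dec_of_sibling h2 h4 (hne _ _)⟩
  · simp only [Finset.mem_biUnion, not_exists, not_and, Finset.mem_union, not_or]
    intro k hk
    obtain ⟨h1, h2, -⟩ := key k hk
    exact ⟨notMem_dec_of_child h1, notMem_dec_of_child h2⟩

theorem brk_eq (s : ℕ × ℕ → ℂ) {e : ℕ × ℕ} (he : e ∈ T.edges) :
    brk n T s e = s e + ∑ k ∈ Finset.Icc 3 (n - 1) with T.par k = e,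
      (brk n T s (T.left k) + brk n T s (T.right k)) :=
  T.sum_dec s he

theorem aA_eq {e : ℕ × ℕ} (he : e ∈ T.edges) :
    aA n T e = 1 + ∑ k ∈ Finset.Icc 3 (n - 1) with T.par k = e,
      (aA n T (T.left k) + aA n T (T.right k)) := by
  simpa only [aA, Finset.card_eq_sum_ones] using T.sum_dec (fun _ => 1) he

theorem odd_aA {e : ℕ × ℕ} (he : e ∈ T.edges) : Odd (aA n T e) := by
  induction h : n - e.2 using Nat.strong_induction_on generalizing e with
  | _ m ih =>
    rw [T.aA_eq he]
    refine odd_one.add_even (Finset.even_sum _ fun k hk => ?_)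
    obtain ⟨hI, rfl⟩ := Finset.mem_filter.1 hk
    obtain ⟨h3, hk⟩ := Finset.mem_Icc.1 hI
    have := (T.lt k h3 hk).2
    exact (ih (n - k) (by omega) (T.left_mem_edges h3 hk) rfl).add_odd
      (ih (n - k) (by omega) (T.right_mem_edges h3 hk) rfl)

/-- Additive telescoping: a sum weighted by `s` becomes a sum over triangles weighted by
brackets. -/
theorem sum_mul_eq_sum_brk (s g : ℕ × ℕ → ℂ) (g12 : g (1, 2) = 0) :
    ∑ e ∈ T.edges.erase (1, 2), s e * g e =
      ∑ k ∈ Finset.Icc 3 (n - 1),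
        (brk n T s (T.left k) * g (T.left k) + brk n T s (T.right k) * g (T.right k) -
          (brk n T s (T.left k) + brk n T s (T.right k)) * g (T.par k)) := by
  rw [Finset.sum_sub_distrib, ← T.sum_edges_erase fun e => brk n T s e * g e,
    ← T.sum_edges_sum_fiber
      (fun k e => (brk n T s (T.left k) + brk n T s (T.right k)) * g e) (by simp [g12]),
    ← Finset.sum_sub_distrib]
  refine Finset.sum_congr rfl fun e he => ?_
  rw [T.brk_eq s (Finset.mem_of_mem_erase he), ← Finset.sum_mul]
  ring

/-- Multiplicative telescoping for the exponents `a_e`. -/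
theorem prod_pow_aA (g : ℕ × ℕ → ℂ) (g12 : g (1, 2) = 1) :
    ∏ k ∈ Finset.Icc 3 (n - 1),
        g (T.left k) ^ aA n T (T.left k) * g (T.right k) ^ aA n T (T.right k) =
      ∏ k ∈ Finset.Icc 3 (n - 1), g (T.left k) * g (T.right k) *
        g (T.par k) ^ (aA n T (T.left k) + aA n T (T.right k)) := by
  rw [Finset.prod_mul_distrib (f := fun k => g (T.left k) * g (T.right k)),
    ← T.prod_edges_erase g, ← T.prod_edges_erase fun e => g e ^ aA n T e,
    ← T.prod_edges_prod_fiber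
      (fun k e => g e ^ (aA n T (T.left k) + aA n T (T.right k))) (by simp [g12]),
    ← Finset.prod_mul_distrib]
  refine Finset.prod_congr rfl fun e he => ?_
  rw [T.aA_eq (Finset.mem_of_mem_erase he), pow_add, pow_one, Finset.prod_pow_eq_pow_sum]

theorem _root_.MinKin.pc_eq_sub (x : Fin (n - 3) → ℂ) {i j : ℕ} (hi : i ≠ n) (hj : j ≠ n) :
    pc n x i j = colB n x j - colB n x i := by
  simp [pc, colA, hi, hj]

theorem _root_.MinKin.dpc_eq_sub (m : Fin (n - 3)) {i j : ℕ} (hi : i ≠ n) (hj : j ≠ n) :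
    dpc n i j m =
      (if j = (m : ℕ) + 3 then (1 : ℂ) else 0) - (if i = (m : ℕ) + 3 then (1 : ℂ) else 0) := by
  simp [dpc, colA, hi, hj]

theorem _root_.MinKin.pc_one_two (hn : 4 ≤ n) (x : Fin (n - 3) → ℂ) : pc n x 1 2 = 1 := by
  rw [pc_eq_sub x (by omega) (by omega)]
  simp [colB]

theorem _root_.MinKin.dpc_one_two (m : Fin (n - 3)) : dpc n 1 2 m = 0 := by
  simp [dpc]

theorem _root_.MinKin.dpc_eq_zero (m : Fin (n - 3)) {i j : ℕ} (hi : i < (m : ℕ) + 3)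
    (hj : j < (m : ℕ) + 3) : dpc n i j m = 0 := by
  simp [dpc, hi.ne, hj.ne]

theorem pc_ne_zero (hn : 4 ≤ n) {x : Fin (n - 3) → ℂ} (hx : x ∈ Udom n) {e : ℕ × ℕ}
    (he : e ∈ T.edges) : pc n x e.1 e.2 ≠ 0 := by
  by_cases h : e = (1, 2)
  · subst h
    simp [pc_one_two hn]
  · exact hx e (T.mem_Sfin_of_mem_edges hn he h)

theorem pc_left_eq_add (x : Fin (n - 3) → ℂ) {k : ℕ} (h3 : 3 ≤ k) (hk : k ≤ n - 1) :
    pc n x (T.par k).1 k = pc n x (T.par k).1 (T.par k).2 + pc n x (T.par k).2 k := by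
  have := T.lt k h3 hk
  rw [pc_eq_sub x (by omega) (by omega), pc_eq_sub x (by omega) (by omega),
    pc_eq_sub x (by omega) (by omega)]
  ring

theorem dpc_left_eq_add (m : Fin (n - 3)) {k : ℕ} (h3 : 3 ≤ k) (hk : k ≤ n - 1) :
    dpc n (T.par k).1 k m = dpc n (T.par k).1 (T.par k).2 m + dpc n (T.par k).2 k m := by
  have := T.lt k h3 hk
  rw [dpc_eq_sub m (by omega) (by omega), dpc_eq_sub m (by omega) (by omega),
    dpc_eq_sub m (by omega) (by omega)]
  ring

/-- At a critical point, the part of the gradient coming from each triangle vanishes. -/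
theorem brk_mul_pc_add_eq_zero (hn : 4 ≤ n) {s : ℕ × ℕ → ℂ} {x : Fin (n - 3) → ℂ}
    (hx : x ∈ Udom n) (hc : IsCrit n (T.edges.erase (1, 2)) s x) {k : ℕ} (h3 : 3 ≤ k)
    (hk : k ≤ n - 1) :
    brk n T s (T.left k) * pc n x (T.par k).2 k + brk n T s (T.right k) * pc n x (T.par k).1 k
      = 0 := by
  induction h : n - k using Nat.strong_induction_on generalizing k with
  | _ d ih =>
    have hm : k - 3 < n - 3 := by omega
    let m : Fin (n - 3) := ⟨k - 3, hm⟩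
    have hmk : (m : ℕ) + 3 = k := Nat.sub_add_cancel h3
    have hlt := T.lt k h3 hk
    have hy := T.pc_ne_zero hn hx (T.left_mem_edges h3 hk)
    have hz := T.pc_ne_zero hn hx (T.right_mem_edges h3 hk)
    have hcm := hc m
    simp only [mul_div_assoc] at hcm
    rw [T.sum_mul_eq_sum_brk s (fun e => dpc n e.1 e.2 m / pc n x e.1 e.2)
      (by simp [dpc_one_two]), Finset.sum_eq_single k] at hcm
    · have h1 : dpc n (T.par k).1 (T.par k).2 m = 0 := dpc_eq_zero m (by omega) (by omega)
      have h2 : dpc n (T.par k).1 k m = 1 := by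
        rw [dpc_eq_sub m (by omega) (by omega), hmk, if_pos rfl, if_neg (by omega), sub_zero]
      have h2' : dpc n (T.par k).2 k m = 1 := by
        rw [dpc_eq_sub m (by omega) (by omega), hmk, if_pos rfl, if_neg (by omega), sub_zero]
      simp only [h1, h2, h2'] at hcm
      field_simp at hcm
      linear_combination hcm
    · intro l hl hlk
      obtain ⟨hl3, hl⟩ := Finset.mem_Icc.1 hl
      have hltl := T.lt l hl3 hl
      rcases lt_or_gt_of_ne hlk with hlk | hlk
      · simp only [dpc_eq_zero m (i := (T.par l).1) (j := l) (by omega) (by omega),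
          dpc_eq_zero m (i := (T.par l).2) (j := l) (by omega) (by omega),
          dpc_eq_zero m (i := (T.par l).1) (j := (T.par l).2) (by omega) (by omega)]
        simp
      · have hrel := ih (n - l) (by omega) hl3 hl rfl
        have hX := T.pc_ne_zero hn hx (T.par_mem_edges hl3 hl)
        have hy := T.pc_ne_zero hn hx (T.left_mem_edges hl3 hl)
        have hz := T.pc_ne_zero hn hx (T.right_mem_edges hl3 hl)
        have hpc := T.pc_left_eq_add x hl3 hl
        have hdpc := T.dpc_left_eq_add m hl3 hl
        simp only at hy hz ⊢
        generalize pc n x (T.par l).1 (T.par l).2 = X at *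
        generalize pc n x (T.par l).1 l = y at *
        generalize pc n x (T.par l).2 l = z at *
        have hb : brk n T s (T.right l) = -(brk n T s (T.left l) * z / y) := by
          field_simp
          linear_combination hrel
        have hX' : X = y - z := by linear_combination -hpc
        rw [hb, hdpc]
        subst hX'
        field_simp
        ring
    · intro h
      exact absurd (Finset.mem_Icc.2 ⟨h3, hk⟩) h

theorem pc_left_eq (hn : 4 ≤ n) {s : ℕ × ℕ → ℂ} (hs : Generic n T s) {x : Fin (n - 3) → ℂ}
    (hx : x ∈ Udom n) (hc : IsCrit n (T.edges.erase (1, 2)) s x) {k : ℕ} (h3 : 3 ≤ k)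
    (hk : k ≤ n - 1) :
    pc n x (T.par k).1 k = brk n T s (T.left k) * pc n x (T.par k).1 (T.par k).2 /
      (brk n T s (T.left k) + brk n T s (T.right k)) := by
  rw [eq_div_iff (hs k h3 hk).2.2]
  linear_combination T.brk_mul_pc_add_eq_zero hn hx hc h3 hk +
    brk n T s (T.left k) * T.pc_left_eq_add x h3 hk

theorem pc_right_eq (hn : 4 ≤ n) {s : ℕ × ℕ → ℂ} (hs : Generic n T s) {x : Fin (n - 3) → ℂ}
    (hx : x ∈ Udom n) (hc : IsCrit n (T.edges.erase (1, 2)) s x) {k : ℕ} (h3 : 3 ≤ k)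
    (hk : k ≤ n - 1) :
    pc n x (T.par k).2 k = -(brk n T s (T.right k) * pc n x (T.par k).1 (T.par k).2) /
      (brk n T s (T.left k) + brk n T s (T.right k)) := by
  rw [eq_div_iff (hs k h3 hk).2.2]
  linear_combination T.brk_mul_pc_add_eq_zero hn hx hc h3 hk -
    brk n T s (T.right k) * T.pc_left_eq_add x h3 hk

/-- The pivot attached to the vertex `k` when the Hessian is diagonalised. -/
def pivot (s : ℕ × ℕ → ℂ) (x : Fin (n - 3) → ℂ) (k : ℕ) : ℂ :=
  (brk n T s (T.left k) + brk n T s (T.right k)) ^ 3 /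
    (brk n T s (T.left k) * brk n T s (T.right k) * pc n x (T.par k).1 (T.par k).2 ^ 2)

/-- The unitriangular matrix diagonalising the Hessian at a critical point. -/
def unitri (s : ℕ × ℕ → ℂ) : Matrix (Fin (n - 3)) (Fin (n - 3)) ℂ :=
  Matrix.of fun k m =>
    (brk n T s (T.right (k + 3)) * dpc n (T.par (k + 3)).1 (k + 3) m +
      brk n T s (T.left (k + 3)) * dpc n (T.par (k + 3)).2 (k + 3) m) /
    (brk n T s (T.left (k + 3)) + brk n T s (T.right (k + 3)))

theorem det_unitri {s : ℕ × ℕ → ℂ} (hs : Generic n T s) : (T.unitri s).det = 1 := by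
  rw [Matrix.det_of_isLowerTriangular]
  · refine Finset.prod_eq_one fun k _ => ?_
    have hk := k.isLt
    have hlt := T.lt (k + 3) (by omega) (by omega)
    have h0 := (hs (k + 3) (by omega) (by omega)).2.2
    have h : ∀ i, i < (k : ℕ) + 3 → dpc n i (k + 3) k = 1 := fun i hi => by
      rw [dpc_eq_sub k (by omega) (by omega), if_pos rfl, if_neg hi.ne, sub_zero]
    rw [unitri, Matrix.of_apply, h _ (by omega), h _ (by omega), mul_one, mul_one, add_comm,
      div_self h0]
  · intro k m hkm
    have hkm : (k : ℕ) < m := hkm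
    have hk := k.isLt
    have hlt := T.lt (k + 3) (by omega) (by omega)
    rw [unitri, Matrix.of_apply, dpc_eq_zero m (by omega) (by omega),
      dpc_eq_zero m (by omega) (by omega)]
    simp

@[to_additive]
theorem _root_.MinKin.prod_Icc_eq_prod_fin {M : Type*} [CommMonoid M] (f : ℕ → M) :
    ∏ k ∈ Finset.Icc 3 (n - 1), f k = ∏ k : Fin (n - 3), f (k + 3) := by
  have h : Finset.Icc 3 (n - 1) = Finset.Ico 3 n := by
    ext k
    simp only [Finset.mem_Icc, Finset.mem_Ico]
    omega
  rw [h, Finset.prod_Ico_eq_prod_range, ← Fin.prod_univ_eq_prod_range]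
  simp only [add_comm 3]

theorem negHess_eq (hn : 4 ≤ n) {s : ℕ × ℕ → ℂ} (hs : Generic n T s) {x : Fin (n - 3) → ℂ}
    (hx : x ∈ Udom n) (hc : IsCrit n (T.edges.erase (1, 2)) s x) :
    negHess n (T.edges.erase (1, 2)) s x =
      (T.unitri s).transpose * Matrix.diagonal (fun k : Fin (n - 3) => T.pivot s x (k + 3)) *
        T.unitri s := by
  ext l m
  rw [Matrix.mul_apply]
  simp only [negHess, Matrix.of_apply, Matrix.mul_diagonal, Matrix.transpose_apply,
    mul_assoc, mul_div_assoc]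
  rw [T.sum_mul_eq_sum_brk s
    (fun e => dpc n e.1 e.2 l * (dpc n e.1 e.2 m / pc n x e.1 e.2 ^ 2)) (by simp [dpc_one_two]),
    sum_Icc_eq_sum_fin]
  refine Finset.sum_congr rfl fun k _ => ?_
  have h3 : 3 ≤ (k : ℕ) + 3 := by omega
  have hk : (k : ℕ) + 3 ≤ n - 1 := by omega
  obtain ⟨ha, hb, hab⟩ := hs _ h3 hk
  have hX := T.pc_ne_zero hn hx (T.par_mem_edges h3 hk)
  simp only [unitri, Matrix.of_apply, pivot]
  rw [T.pc_left_eq hn hs hx hc h3 hk, T.pc_right_eq hn hs hx hc h3 hk,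
    T.dpc_left_eq_add l h3 hk, T.dpc_left_eq_add m h3 hk]
  generalize pc n x (T.par (k + 3)).1 (T.par (k + 3)).2 = X at *
  generalize brk n T s (T.left (k + 3)) = a at *
  generalize brk n T s (T.right (k + 3)) = b at *
  field_simp
  ring

theorem det_negHess_eq_prod_pivot (hn : 4 ≤ n) {s : ℕ × ℕ → ℂ} (hs : Generic n T s)
    {x : Fin (n - 3) → ℂ} (hx : x ∈ Udom n) (hc : IsCrit n (T.edges.erase (1, 2)) s x) :
    (negHess n (T.edges.erase (1, 2)) s x).det = ∏ k ∈ Finset.Icc 3 (n - 1), T.pivot s x k := by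
  rw [T.negHess_eq hn hs hx hc, Matrix.det_mul, Matrix.det_mul, Matrix.det_transpose,
    T.det_unitri hs, Matrix.det_diagonal, prod_Icc_eq_prod_fin, one_mul, mul_one]

theorem prod_pivot_eq (hn : 4 ≤ n) {s : ℕ × ℕ → ℂ} (hs : Generic n T s)
    {x : Fin (n - 3) → ℂ} (hx : x ∈ Udom n) (hc : IsCrit n (T.edges.erase (1, 2)) s x) :
    ∏ k ∈ Finset.Icc 3 (n - 1), T.pivot s x k = ∏ k ∈ Finset.Icc 3 (n - 1),
      (brk n T s (T.left k) + brk n T s (T.right k)) ^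
          (aA n T (T.left k) + aA n T (T.right k) + 1) /
        (brk n T s (T.left k) ^ aA n T (T.left k) *
          brk n T s (T.right k) ^ aA n T (T.right k)) := by
  have key := T.prod_pow_aA (fun e => pc n x e.1 e.2) (pc_one_two hn x)
  have hL : ∀ k ∈ Finset.Icc 3 (n - 1),
      pc n x (T.left k).1 (T.left k).2 ^ aA n T (T.left k) *
          pc n x (T.right k).1 (T.right k).2 ^ aA n T (T.right k) =
        T.pivot s x k / ((brk n T s (T.left k) + brk n T s (T.right k)) ^
          (aA n T (T.left k) + aA n T (T.right k) + 1) /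
        (brk n T s (T.left k) ^ aA n T (T.left k) *
          brk n T s (T.right k) ^ aA n T (T.right k))) *
        (pc n x (T.left k).1 (T.left k).2 * pc n x (T.right k).1 (T.right k).2 *
          pc n x (T.par k).1 (T.par k).2 ^ (aA n T (T.left k) + aA n T (T.right k))) := by
    intro k hk
    obtain ⟨h3, hk⟩ := Finset.mem_Icc.1 hk
    obtain ⟨ha, hb, hab⟩ := hs k h3 hk
    have hX := T.pc_ne_zero hn hx (T.par_mem_edges h3 hk)
    have hodd := T.odd_aA (T.right_mem_edges h3 hk)
    simp only [pivot]
    rw [T.pc_left_eq hn hs hx hc h3 hk, T.pc_right_eq hn hs hx hc h3 hk]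
    generalize pc n x (T.par k).1 (T.par k).2 = X at *
    generalize brk n T s (T.left k) = a at *
    generalize brk n T s (T.right k) = b at *
    rw [div_pow, div_pow, hodd.neg_pow, mul_pow, mul_pow]
    field_simp
    ring
  rw [Finset.prod_congr rfl hL, Finset.prod_mul_distrib, Finset.prod_div_distrib] at key
  have hne : ∏ k ∈ Finset.Icc 3 (n - 1),
      (pc n x (T.left k).1 (T.left k).2 * pc n x (T.right k).1 (T.right k).2 *
        pc n x (T.par k).1 (T.par k).2 ^ (aA n T (T.left k) + aA n T (T.right k))) ≠ 0 := by
    refine Finset.prod_ne_zero_iff.2 fun k hk => ?_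
    obtain ⟨h3, hk⟩ := Finset.mem_Icc.1 hk
    exact mul_ne_zero (mul_ne_zero (T.pc_ne_zero hn hx (T.left_mem_edges h3 hk))
      (T.pc_ne_zero hn hx (T.right_mem_edges h3 hk)))
      (pow_ne_zero _ (T.pc_ne_zero hn hx (T.par_mem_edges h3 hk)))
  refine eq_of_div_eq_one (mul_right_cancel₀ hne ?_)
  rw [one_mul]
  exact key

end TwoTree

/-- the determinant of the negated Hessian at the critical point
equals Π_{triangles} ([s_{ik}]+[s_{jk}])^{b_k} / ([s_{ik}]^{a_{ik}}·[s_{jk}]^{a_{jk}});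
equivalently det Hess(L_T)(xh) is (-1)^{n-3} times this product. -/
theorem hessian_determinant_formula (n : ℕ) (hn : 4 ≤ n) (T : TwoTree n)
    (s : ℕ × ℕ → ℂ) (hs : Generic n T s) (xh : Fin (n - 3) → ℂ)
    (hx : xh ∈ Udom n) (hc : IsCrit n (T.edges.erase (1, 2)) s xh) :
    (negHess n (T.edges.erase (1, 2)) s xh).det =
        (∏ k ∈ Finset.Icc 3 (n - 1),
          (brk n T s ((T.par k).1, k) + brk n T s ((T.par k).2, k)) ^
              (aA n T ((T.par k).1, k) + aA n T ((T.par k).2, k) + 1)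
            / (brk n T s ((T.par k).1, k) ^ aA n T ((T.par k).1, k) *
                brk n T s ((T.par k).2, k) ^ aA n T ((T.par k).2, k))) ∧
      (-(negHess n (T.edges.erase (1, 2)) s xh)).det =
        (-1 : ℂ) ^ (n - 3) *
          ∏ k ∈ Finset.Icc 3 (n - 1),
            (brk n T s ((T.par k).1, k) + brk n T s ((T.par k).2, k)) ^
                (aA n T ((T.par k).1, k) + aA n T ((T.par k).2, k) + 1)
              / (brk n T s ((T.par k).1, k) ^ aA n T ((T.par k).1, k) *
                  brk n T s ((T.par k).2, k) ^ aA n T ((T.par k).2, k)) := by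
  have hdet := (T.det_negHess_eq_prod_pivot hn hs hx hc).trans (T.prod_pivot_eq hn hs hx hc)
  exact ⟨hdet, by rw [Matrix.det_neg, hdet, Fintype.card_fin]⟩

end
end MinKin
end
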